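/- arXiv:2109.03032 — 9 statements merged into one kernel-verified Lean document; each statement's English description precedes it below -/
import Mathlib

section
/- Let N be a positive even integer and let β be an integer with 1 ≤ β < N. Let k be the additive order of β modulo N, i.e., the smallest positive integer k such that k·β ≡ 0 (mod N). Then an optimal packing for parameters N and β exists if and only if k is even. -/
/-- `C` is an optimal packing for parameters `N` and `β`: the set of client slots `C`
and its translate `C + β` (the server slots) are disjoint and together cover all of
`ZMod N`. -/
def IsOptimalPacking (N : ℕ) (β : ℕ) (C : Set (ZMod N)) : Prop :=
  Disjoint C ((fun c => c + (β : ZMod N)) '' C) ∧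
    C ∪ ((fun c => c + (β : ZMod N)) '' C) = Set.univ

/-- A set and its translate by `b` partition a group exactly when translation by `b`
exchanges the set with its complement. -/
theorem disjoint_and_union_image_add_right_eq_univ_iff {G : Type*} [AddGroup G] (b : G)
    (C : Set G) :
    (Disjoint C ((fun c => c + b) '' C) ∧ C ∪ ((fun c => c + b) '' C) = Set.univ) ↔
      ∀ x, x + b ∈ C ↔ x ∉ C := by
  have mem_image (x : G) : x + b ∈ (fun c => c + b) '' C ↔ x ∈ C :=
    (add_left_injective b).mem_set_image
  rw [Set.disjoint_left, Set.eq_univ_iff_forall, ← forall_and,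
    (Equiv.addRight b).surjective.forall]
  refine forall_congr' fun x => ?_
  rw [Equiv.coe_addRight, Set.mem_union, mem_image]
  tauto

theorem add_nsmul_mem_iff_of_add_mem_iff_notMem {G : Type*} [AddMonoid G] {b : G} {C : Set G}
    (h : ∀ x, x + b ∈ C ↔ x ∉ C) (x : G) (n : ℕ) : x + n • b ∈ C ↔ (x ∈ C ↔ Even n) := by
  induction n with
  | zero => simp
  | succ n ih =>
    rw [succ_nsmul, ← add_assoc, h, ih, Nat.even_add_one]
    tauto

/-- Every coset of the subgroup generated by `b` can be two-coloured alternately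
when `b` has even (or infinite) order. -/
theorem exists_set_forall_add_mem_iff_notMem {G : Type*} [AddCommGroup G] {b : G}
    (hb : Even (addOrderOf b)) : ∃ C : Set G, ∀ x, x + b ∈ C ↔ x ∉ C := by
  let r : G → G := fun x => (QuotientAddGroup.mk x : G ⧸ AddSubgroup.zmultiples b).out
  have hr (x : G) : ∃ n : ℤ, x = r x + n • b := by
    obtain ⟨⟨_, n, rfl⟩, hn⟩ := QuotientAddGroup.mk_out_eq_add (AddSubgroup.zmultiples b) x
    exact ⟨-n, by simp [r, hn]⟩
  have hr_add (x : G) : r (x + b) = r x := by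
    simp only [r]
    congr 1
    exact QuotientAddGroup.mk_add_of_mem x (AddSubgroup.mem_zmultiples b)
  have parity {m n : ℤ} (h : m • b = n • b) : Even m ↔ Even n := by
    have hd : (addOrderOf b : ℤ) ∣ m - n := by
      rw [addOrderOf_dvd_iff_zsmul_eq_zero, sub_zsmul, h, add_neg_cancel]
    rw [← Int.even_sub, even_iff_two_dvd]
    exact (Int.natCast_dvd_natCast.mpr hb.two_dvd).trans hd
  refine ⟨{x | ∃ n : ℤ, Even n ∧ x = r x + n • b}, fun x => ?_⟩
  obtain ⟨n, hn⟩ := hr x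
  have mem_iff {y : G} {m : ℤ} (hm : y = r y + m • b) :
      (∃ l : ℤ, Even l ∧ y = r y + l • b) ↔ Even m :=
    ⟨fun ⟨_, hl, hy⟩ => (parity (add_left_cancel (hm.symm.trans hy))).mpr hl,
      fun h => ⟨m, h, hm⟩⟩
  have hn' : x + b = r (x + b) + (n + 1) • b := by
    rw [hr_add, add_zsmul, one_zsmul, ← add_assoc, ← hn]
  rw [Set.mem_ofPred_eq, Set.mem_ofPred_eq, mem_iff hn, mem_iff hn', Int.even_add_one]

theorem optimal_packing_iff_even_order
    (N : ℕ) (hN : 0 < N) (hNe : Even N) (β : ℕ) (hβ1 : 1 ≤ β) (hβN : β < N)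
    (k : ℕ) (hk : k = addOrderOf ((β : ZMod N))) :
    (∃ C : Set (ZMod N), IsOptimalPacking N β C) ↔ Even k := by
  subst hk
  simp only [IsOptimalPacking, disjoint_and_union_image_add_right_eq_univ_iff]
  refine ⟨fun ⟨C, h⟩ => ?_, exists_set_forall_add_mem_iff_notMem⟩
  have := add_nsmul_mem_iff_of_add_mem_iff_notMem h 0 (addOrderOf (β : ZMod N))
  rw [addOrderOf_nsmul_eq_zero, add_zero] at this
  tauto
end

section
/- Let N be a positive integer and let β be an integer with 1 ≤ β < N. Let k be the additive order of β modulo N and suppose k is even, and set h = N/k. Then the set C = { (i + 2m·β) mod N : 0 ≤ i ≤ h−1, 0 ≤ m ≤ k/2 − 1 } is an optimal packing for parameters N and β; that is, C and C + β are disjoint and C ∪ (C + β) = ZMod N. -/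
/-- The quotient of `N` by the additive order of `β` in `ZMod N` is `gcd N β`. -/
theorem ZMod.div_addOrderOf_natCast {N : ℕ} (hN : 0 < N) (β : ℕ) :
    N / addOrderOf (β : ZMod N) = N.gcd β := by
  rw [ZMod.addOrderOf_coe β hN.ne', Nat.div_div_self (Nat.gcd_dvd_left N β) hN.ne']

/-- Every residue modulo `N` is a multiple of `β` plus a remainder below `gcd N β`. -/
theorem ZMod.exists_eq_add_mul_natCast {N : ℕ} (hN : 0 < N) (β : ℕ) (x : ZMod N) :
    ∃ i < N.gcd β, ∃ j < addOrderOf (β : ZMod N), x = (i : ZMod N) + (j : ZMod N) * β := by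
  have : NeZero N := ⟨hN.ne'⟩
  refine ⟨x.val % N.gcd β, Nat.mod_lt _ (Nat.gcd_pos_of_pos_left _ hN), ?_⟩
  have hgcd : ((N.gcd β : ℕ) : ZMod N) = (β : ZMod N) * (N.gcdB β : ZMod N) := by
    have := congrArg (Int.cast : ℤ → ZMod N) (Nat.gcd_eq_gcd_ab N β)
    simpa using this
  have hx : x = ((x.val % N.gcd β : ℕ) : ZMod N)
      + (N.gcd β : ZMod N) * ((x.val / N.gcd β : ℕ) : ZMod N) := by
    rw [← Nat.cast_mul, ← Nat.cast_add, Nat.mod_add_div, ZMod.natCast_zmod_val]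
  have hmem : (N.gcd β : ZMod N) * ((x.val / N.gcd β : ℕ) : ZMod N)
      ∈ AddSubgroup.zmultiples (β : ZMod N) := by
    refine AddSubgroup.mem_zmultiples_iff.2 ⟨N.gcdB β * (x.val / N.gcd β : ℕ), ?_⟩
    rw [hgcd, zsmul_eq_mul, Int.cast_mul, Int.cast_natCast]
    ring
  rw [mem_zmultiples_iff_mem_range_addOrderOf, Finset.mem_image] at hmem
  obtain ⟨j, hj, hjx⟩ := hmem
  refine ⟨j, Finset.mem_range.1 hj, ?_⟩
  rw [← nsmul_eq_mul, hjx]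
  exact hx

/-- The remainder and the multiple in `ZMod.exists_eq_add_mul_natCast` are unique. -/
theorem ZMod.add_mul_natCast_inj {N β i i' j j' : ℕ} (hi : i < N.gcd β) (hi' : i' < N.gcd β)
    (hj : j < addOrderOf (β : ZMod N)) (hj' : j' < addOrderOf (β : ZMod N))
    (heq : (i : ZMod N) + (j : ZMod N) * β = (i' : ZMod N) + (j' : ZMod N) * β) :
    i = i' ∧ j = j' := by
  have hmod : i + j * β ≡ i' + j' * β [MOD N.gcd β] := by
    refine Nat.ModEq.of_dvd (Nat.gcd_dvd_left N β) ((ZMod.natCast_eq_natCast_iff _ _ _).1 ?_)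
    exact_mod_cast heq
  have hzero (l : ℕ) : l * β ≡ 0 [MOD N.gcd β] :=
    (Nat.modEq_zero_iff_dvd).2 ((Nat.gcd_dvd_right N β).mul_left l)
  have hii : i = i' :=
    (Nat.ModEq.add_right_cancel ((hzero j).trans (hzero j').symm) hmod).eq_of_lt_of_lt hi hi'
  subst hii
  refine ⟨rfl, nsmul_injOn_Iio_addOrderOf (x := (β : ZMod N)) hj hj' ?_⟩
  simpa only [nsmul_eq_mul] using add_left_cancel heq

theorem explicit_optimal_packing
    (N : ℕ) (hN : 0 < N) (β : ℕ) (hβ1 : 1 ≤ β) (hβN : β < N)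
    (k : ℕ) (hk : k = addOrderOf ((β : ZMod N))) (hke : Even k)
    (h : ℕ) (hh : h = N / k) :
    IsOptimalPacking N β
      {x : ZMod N | ∃ i < h, ∃ m < k / 2, x = (i : ZMod N) + (2 * m : ℕ) * (β : ZMod N)} := by
  obtain rfl : h = N.gcd β := by rw [hh, hk, ZMod.div_addOrderOf_natCast hN]
  obtain ⟨r, hr⟩ := hke
  constructor
  · rw [Set.disjoint_left]
    rintro x ⟨i, hi, m, hm, hx⟩ ⟨y, ⟨i', hi', m', hm', hy⟩, hyx⟩
    have heq : (i : ZMod N) + ((2 * m : ℕ) : ZMod N) * β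
        = (i' : ZMod N) + ((2 * m' + 1 : ℕ) : ZMod N) * β := by
      rw [← hx, ← hyx, hy]
      push_cast
      ring
    have := (ZMod.add_mul_natCast_inj hi hi' (by omega) (by omega) heq).2
    omega
  · refine Set.eq_univ_of_forall fun x => ?_
    obtain ⟨i, hi, j, hj, hx⟩ := ZMod.exists_eq_add_mul_natCast hN β x
    obtain ⟨m, rfl | rfl⟩ := j.even_or_odd'
    · exact Or.inl ⟨i, hi, m, by omega, hx⟩
    · refine Or.inr ⟨_, ⟨i, hi, m, by omega, rfl⟩, ?_⟩
      rw [hx]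
      push_cast
      ring
end

section
/- Let N be a positive even integer and let β be an integer with 1 ≤ β < N such that gcd(β, N) = 1 (equivalently, the additive order of β modulo N equals N). Then there are exactly two optimal packings for parameters N and β, namely C₀ = { (2m·β) mod N : 0 ≤ m ≤ N/2 − 1 } (the even multiples of β) and C₁ = { ((2m+1)·β) mod N : 0 ≤ m ≤ N/2 − 1 } (the odd multiples of β). -/
theorem isOptimalPacking_iff_add_mem {N β : ℕ} {C : Set (ZMod N)} :
    IsOptimalPacking N β C ↔ ∀ x : ZMod N, x + β ∈ C ↔ x ∉ C := by
  have himage (x : ZMod N) : x + β ∈ (fun c => c + (β : ZMod N)) '' C ↔ x ∈ C := by simp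
  constructor
  · rintro ⟨hdisj, hcover⟩ x
    have hd : x + β ∈ C → x ∉ C := fun h h' =>
      Set.disjoint_left.1 hdisj h ((himage x).2 h')
    have hc : x + (β : ZMod N) ∈ C ∪ (fun c => c + (β : ZMod N)) '' C := by
      rw [hcover]; trivial
    rw [Set.mem_union, himage] at hc
    tauto
  · intro h
    refine ⟨Set.disjoint_left.2 ?_, Set.eq_univ_of_forall fun y => ?_⟩
    · rintro _ hy ⟨x, hx, rfl⟩
      exact (h x).1 hy hx
    · have hy := h (y - β)
      have hi := himage (y - β)
      rw [sub_add_cancel] at hy hi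
      rw [Set.mem_union, hi]
      tauto

theorem IsOptimalPacking.natCast_mul_mem_iff {N β : ℕ} {C : Set (ZMod N)}
    (hC : IsOptimalPacking N β C) (k : ℕ) :
    (k : ZMod N) * β ∈ C ↔ (Even k ↔ (0 : ZMod N) ∈ C) := by
  induction k with
  | zero => simp
  | succ k ih =>
    have h := isOptimalPacking_iff_add_mem.1 hC ((k : ZMod N) * β)
    rw [Nat.cast_add_one, add_one_mul, h, ih, Nat.even_add_one]
    tauto

theorem ZMod.exists_eq_natCast_mul {N β : ℕ} [NeZero N] (h : β.Coprime N) (x : ZMod N) :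
    ∃ k : ℕ, x = k * β := by
  refine ⟨(x * (β : ZMod N)⁻¹).val, ?_⟩
  rw [ZMod.natCast_zmod_val, mul_assoc, mul_comm (_⁻¹), ZMod.coe_mul_inv_eq_one β h, mul_one]

theorem ZMod.exists_natCast_mul_eq_iff_mod_two {N β r : ℕ} (hN : 0 < N) (hNe : Even N)
    (h : β.Coprime N) (hr : r < 2) (k : ℕ) :
    (∃ m < N / 2, (k : ZMod N) * β = (2 * m + r : ℕ) * (β : ZMod N)) ↔ k % 2 = r := by
  have hcancel (a b : ℕ) : (a : ZMod N) * β = b * β ↔ a ≡ b [MOD N] := by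
    rw [((ZMod.isUnit_iff_coprime β N).2 h).mul_left_inj, ZMod.natCast_eq_natCast_iff]
  have hdvd : 2 ∣ N := hNe.two_dvd
  simp only [hcancel]
  constructor
  · rintro ⟨m, -, hm⟩
    have := hm.of_dvd hdvd
    unfold Nat.ModEq at this
    omega
  · intro hk
    have hmod : k % N % 2 = k % 2 := Nat.mod_mod_of_dvd k hdvd
    have hlt : k % N < N := Nat.mod_lt k hN
    refine ⟨k % N / 2, by omega, ?_⟩
    rw [show 2 * (k % N / 2) + r = k % N by omega]
    exact (Nat.mod_modEq k N).symm

theorem exactly_two_optimal_packings_of_coprime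
    (N : ℕ) (hN : 0 < N) (hNe : Even N) (β : ℕ) (hβ1 : 1 ≤ β) (hβN : β < N)
    (hgcd : Nat.gcd β N = 1)
    (C₀ C₁ : Set (ZMod N))
    (hC₀ : C₀ = {x : ZMod N | ∃ m < N / 2, x = (2 * m : ℕ) * (β : ZMod N)})
    (hC₁ : C₁ = {x : ZMod N | ∃ m < N / 2, x = (2 * m + 1 : ℕ) * (β : ZMod N)}) :
    {C : Set (ZMod N) | IsOptimalPacking N β C} = {C₀, C₁} ∧ C₀ ≠ C₁ := by
  have : NeZero N := ⟨hN.ne'⟩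
  have hmem₀ (k : ℕ) : (k : ZMod N) * β ∈ C₀ ↔ Even k := by
    rw [hC₀, Nat.even_iff]
    exact ZMod.exists_natCast_mul_eq_iff_mod_two (r := 0) hN hNe hgcd (by norm_num) k
  have hmem₁ (k : ℕ) : (k : ZMod N) * β ∈ C₁ ↔ ¬ Even k := by
    rw [hC₁, Nat.not_even_iff]
    exact ZMod.exists_natCast_mul_eq_iff_mod_two (r := 1) hN hNe hgcd (by norm_num) k
  refine ⟨Set.ext fun C => ?_, fun h => ?_⟩
  · rw [Set.mem_ofPred_eq, Set.mem_insert_iff, Set.mem_singleton_iff]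
    constructor
    · intro hC
      by_cases h0 : (0 : ZMod N) ∈ C
      · refine Or.inl (Set.ext fun x => ?_)
        obtain ⟨k, rfl⟩ := ZMod.exists_eq_natCast_mul hgcd x
        rw [hC.natCast_mul_mem_iff, hmem₀, iff_true_right h0]
      · refine Or.inr (Set.ext fun x => ?_)
        obtain ⟨k, rfl⟩ := ZMod.exists_eq_natCast_mul hgcd x
        rw [hC.natCast_mul_mem_iff, hmem₁, iff_false_right h0]
    · rintro (rfl | rfl) <;> refine isOptimalPacking_iff_add_mem.2 fun x => ?_ <;>
        obtain ⟨k, rfl⟩ := ZMod.exists_eq_natCast_mul hgcd x <;>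
        rw [← add_one_mul, ← Nat.cast_add_one]
      · rw [hmem₀, hmem₀, Nat.even_add_one]
      · rw [hmem₁, hmem₁, Nat.even_add_one]
  · have h0 := hmem₁ 0
    rw [← h, hmem₀] at h0
    exact iff_not_self h0
end

section
/- Let N be a positive integer and let β be an integer with 1 ≤ β < N. Let k be the additive order of β modulo N and suppose k is even, and set h = N/k. Then the number of distinct optimal packings for parameters N and β is exactly 2^h. -/
/-- Optimal packings are the sets whose membership alternates along every orbit of `x ↦ x + β`. -/
theorem isOptimalPacking_iff (N β : ℕ) (C : Set (ZMod N)) :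
    IsOptimalPacking N β C ↔ ∀ x, x + (β : ZMod N) ∈ C ↔ x ∉ C := by
  have himage (x : ZMod N) : x + (β : ZMod N) ∈ (fun c => c + (β : ZMod N)) '' C ↔ x ∈ C :=
    (add_left_injective (β : ZMod N)).mem_set_image
  constructor
  · rintro ⟨hdisj, hunion⟩ x
    refine ⟨fun hxβ hx => Set.disjoint_left.mp hdisj hxβ ((himage x).mpr hx), fun hx => ?_⟩
    have hmem : x + (β : ZMod N) ∈ C ∪ (fun c => c + (β : ZMod N)) '' C :=
      hunion ▸ Set.mem_univ _
    exact hmem.resolve_right (mt (himage x).mp hx)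
  · intro halt
    refine ⟨Set.disjoint_right.mpr ?_, Set.eq_univ_of_forall fun y => ?_⟩
    · rintro _ ⟨c, hc, rfl⟩ hcβ
      exact (halt c).mp hcβ hc
    · obtain ⟨x, rfl⟩ : ∃ x, x + (β : ZMod N) = y := ⟨y - β, sub_add_cancel _ _⟩
      by_cases hx : x ∈ C
      · exact Or.inr ((himage x).mpr hx)
      · exact Or.inl ((halt x).mpr hx)

section Alternating

variable {G : Type*} [AddCommGroup G]

/-- If `b` has even additive order, some set alternates along every orbit of `x ↦ x + b`. -/
theorem exists_alternating_set {b : G} (hb : Even (addOrderOf b)) :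
    ∃ E : Set G, ∀ x, x + b ∈ E ↔ x ∉ E := by
  let r (x : G) : G := (QuotientAddGroup.mk x : G ⧸ AddSubgroup.zmultiples b).out
  have hr (x : G) : r (x + b) = r x :=
    congrArg Quotient.out
      (QuotientAddGroup.mk_add_of_mem x (AddSubgroup.mem_zmultiples b))
  have hrep (x : G) : ∃ n : ℤ, x = r x + n • b := by
    obtain ⟨⟨_, n, rfl⟩, hn⟩ :=
      QuotientAddGroup.mk_out_eq_add (AddSubgroup.zmultiples b) x
    refine ⟨-n, ?_⟩
    change r x = x + n • b at hn
    rw [hn, neg_smul, add_neg_cancel_right]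
  refine ⟨{x | ∃ n : ℤ, Even n ∧ x = r x + n • b}, fun x => ⟨?_, fun hx => ?_⟩⟩
  · rintro ⟨m, hm, hxm⟩ ⟨n, hn, hxn⟩
    rw [hr] at hxm
    have hzero : (m - n - 1) • b = 0 := by
      have hshift : r x + n • b + b = r x + m • b := by rw [← hxn, hxm]
      rw [add_assoc, add_right_inj] at hshift
      rw [sub_smul, sub_smul, ← hshift, one_smul]
      abel
    have hdvd := addOrderOf_dvd_iff_zsmul_eq_zero.mpr hzero
    have heven : Even (m - n - 1) := by
      obtain ⟨j, hj⟩ := hb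
      obtain ⟨i, hi⟩ := hdvd
      rw [hi, hj]
      exact ⟨j * i, by push_cast; ring⟩
    grind
  · obtain ⟨n, hn⟩ := hrep x
    have hodd : ¬ Even n := fun heven => hx ⟨n, heven, hn⟩
    refine ⟨n + 1, by grind, ?_⟩
    rw [hr, add_smul, one_smul, ← add_assoc, ← hn]

/-- A set invariant under translation by `b` is a union of cosets of the multiples of `b`. -/
theorem exists_preimage_mk_eq_of_add_mem_iff {b : G} {D : Set G}
    (hD : ∀ x, x + b ∈ D ↔ x ∈ D) :
    ∃ S : Set (G ⧸ AddSubgroup.zmultiples b), QuotientAddGroup.mk ⁻¹' S = D := by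
  have hzsmul (n : ℤ) : ∀ x, x + n • b ∈ D ↔ x ∈ D := by
    induction n with
    | zero => simp
    | succ n ih =>
      intro x
      rw [add_smul, one_smul, ← add_assoc, hD, ih]
    | pred n ih =>
      intro x
      rw [← hD, sub_smul, one_smul, add_assoc, sub_add_cancel, ih]
  refine ⟨QuotientAddGroup.mk '' D, Set.Subset.antisymm ?_ (Set.subset_preimage_image _ _)⟩
  rintro x ⟨y, hy, hxy⟩
  obtain ⟨n, hn⟩ := QuotientAddGroup.eq.mp hxy
  change n • b = -y + x at hn
  rw [← add_neg_cancel_left y x, ← hn]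
  exact (hzsmul n y).mpr hy

/-- If `b` has even additive order, each coset of the multiples of `b` admits two alternating
assignments, and these choices are independent. -/
theorem ncard_alternating_sets [Finite G] {b : G} (hb : Even (addOrderOf b)) :
    {C : Set G | ∀ x, x + b ∈ C ↔ x ∉ C}.ncard = 2 ^ (AddSubgroup.zmultiples b).index := by
  obtain ⟨E, hE⟩ := exists_alternating_set hb
  let f (S : Set (G ⧸ AddSubgroup.zmultiples b)) : Set G :=
    symmDiff E (QuotientAddGroup.mk ⁻¹' S)
  have hf : Function.Injective f :=
    (symmDiff_right_injective E).comp QuotientAddGroup.mk_surjective.preimage_injective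
  have hrange : {C : Set G | ∀ x, x + b ∈ C ↔ x ∉ C} = Set.range f := by
    ext C
    constructor
    · intro hC
      obtain ⟨S, hS⟩ := exists_preimage_mk_eq_of_add_mem_iff (b := b) (D := symmDiff E C) (by
        intro x
        have hCx := hC x
        have hEx := hE x
        simp only [Set.mem_symmDiff]
        tauto)
      exact ⟨S, by simp only [f, hS, symmDiff_symmDiff_cancel_left]⟩
    · rintro ⟨S, rfl⟩ x
      have hmk : (QuotientAddGroup.mk (x + b) : G ⧸ AddSubgroup.zmultiples b) = x :=
        QuotientAddGroup.mk_add_of_mem x (AddSubgroup.mem_zmultiples b)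
      have hEx := hE x
      simp only [f, Set.mem_symmDiff, Set.mem_preimage, hmk]
      tauto
  have := Fintype.ofFinite (G ⧸ AddSubgroup.zmultiples b)
  rw [hrange, ← Set.image_univ, Set.ncard_image_of_injective _ hf, Set.ncard_univ,
    Nat.card_eq_fintype_card, Fintype.card_set, AddSubgroup.index, Nat.card_eq_fintype_card]

end Alternating

theorem card_optimal_packings
    (N : ℕ) (hN : 0 < N) (β : ℕ) (hβ1 : 1 ≤ β) (hβN : β < N)
    (k : ℕ) (hk : k = addOrderOf ((β : ZMod N))) (hke : Even k)
    (h : ℕ) (hh : h = N / k) :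
    {C : Set (ZMod N) | IsOptimalPacking N β C}.ncard = 2 ^ h := by
  have : NeZero N := ⟨hN.ne'⟩
  have hindex : (AddSubgroup.zmultiples (β : ZMod N)).index = h := by
    have hcard := (AddSubgroup.zmultiples (β : ZMod N)).card_mul_index
    rw [Nat.card_zmultiples, Nat.card_zmod, ← hk] at hcard
    rw [hh, Nat.div_eq_of_eq_mul_right (hk ▸ addOrderOf_pos _) hcard.symm]
  simp only [isOptimalPacking_iff]
  rw [ncard_alternating_sets (hk ▸ hke), hindex]
end

section
/- Let N = 2^n for some positive integer n. Then for every integer β with 1 ≤ β < N, an optimal packing for parameters N and β exists. -/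
/-- A set that translation by `β` exchanges with its complement is an optimal packing. -/
theorem IsOptimalPacking.of_add_mem_iff {N β : ℕ} {C : Set (ZMod N)}
    (h : ∀ x, x + (β : ZMod N) ∈ C ↔ x ∉ C) : IsOptimalPacking N β C := by
  refine ⟨Set.disjoint_left.2 ?_, Set.eq_univ_of_forall fun x => ?_⟩
  · rintro _ hx ⟨c, hc, rfl⟩
    exact (h c).1 hx hc
  · by_cases hx : x ∈ C
    · exact Or.inl hx
    · refine Or.inr ⟨x - β, ?_, sub_add_cancel x _⟩
      by_contra hc
      exact hx (by simpa using (h (x - β)).2 hc)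

/-- Adding an odd multiple of `2 ^ k` flips the `k`-th binary digit. -/
theorem Nat.testBit_add_two_pow_mul_odd (a k : ℕ) {m : ℕ} (hm : Odd m) :
    (a + 2 ^ k * m).testBit k = !a.testBit k := by
  obtain ⟨r, rfl⟩ := hm
  rw [Nat.testBit_eq_decide_div_mod_eq, Nat.testBit_eq_decide_div_mod_eq,
    Nat.add_mul_div_left _ _ (Nat.two_pow_pos k), ← decide_not, decide_eq_decide]
  omega

theorem optimal_packing_exists_of_pow_two
    (n : ℕ) (hn : 1 ≤ n) (N : ℕ) (hN : N = 2 ^ n)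
    (β : ℕ) (hβ1 : 1 ≤ β) (hβN : β < N) :
    ∃ C : Set (ZMod N), IsOptimalPacking N β C := by
  obtain ⟨k, m, hm, rfl⟩ := Nat.exists_eq_two_pow_mul_odd (n := β) (by omega)
  subst hN
  have hk : k < n := (Nat.pow_lt_pow_iff_right one_lt_two).1
    ((Nat.le_mul_of_pos_right _ hm.pos).trans_lt hβN)
  refine ⟨{x | x.val.testBit k = false}, .of_add_mem_iff fun x => ?_⟩
  rw [Set.mem_ofPred_eq, Set.mem_ofPred_eq, ZMod.val_add, ZMod.val_natCast_of_lt hβN,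
    Nat.testBit_mod_two_pow, Nat.testBit_add_two_pow_mul_odd _ _ hm]
  simp [hk]
end

section
/- Let N = m·2^g where m is an odd integer greater than 1 and g ≥ 1, and let β = 2^g. Then the additive order of β modulo N equals m, which is odd, and consequently no optimal packing for parameters N and β exists. -/
theorem IsOptimalPacking.add_mem_iff {N β : ℕ} {C : Set (ZMod N)} (h : IsOptimalPacking N β C)
    (x : ZMod N) : x + (β : ZMod N) ∈ C ↔ x ∉ C := by
  obtain ⟨hdisj, hcover⟩ := h
  constructor
  · intro hx hxC
    exact Set.disjoint_left.mp hdisj hx ⟨x, hxC, rfl⟩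
  · intro hx
    rcases hcover.ge (Set.mem_univ (x + (β : ZMod N))) with hC | ⟨c, hc, hcx⟩
    · exact hC
    · exact absurd (add_right_cancel hcx ▸ hc) hx

theorem IsOptimalPacking.nsmul_mem_iff {N β : ℕ} {C : Set (ZMod N)} (h : IsOptimalPacking N β C)
    (k : ℕ) : k • (β : ZMod N) ∈ C ↔ (Even k ↔ (0 : ZMod N) ∈ C) := by
  induction k with
  | zero => simp
  | succ k ih => rw [succ_nsmul, h.add_mem_iff, ih, Nat.even_add_one]; tauto

theorem IsOptimalPacking.even_addOrderOf {N β : ℕ} {C : Set (ZMod N)}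
    (h : IsOptimalPacking N β C) : Even (addOrderOf (β : ZMod N)) := by
  have key := h.nsmul_mem_iff (addOrderOf (β : ZMod N))
  rw [addOrderOf_nsmul_eq_zero] at key
  tauto

theorem no_optimal_packing_of_odd_order
    (m g : ℕ) (hm : Odd m) (hm1 : 1 < m) (hg : 1 ≤ g)
    (N : ℕ) (hN : N = m * 2 ^ g) (β : ℕ) (hβ : β = 2 ^ g) :
    addOrderOf ((β : ZMod N)) = m ∧ Odd m ∧
      ¬ ∃ C : Set (ZMod N), IsOptimalPacking N β C := by
  have horder : addOrderOf (β : ZMod N) = m := by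
    have hβ0 : 0 < β := hβ ▸ by positivity
    rw [← hβ] at hN
    have hN0 : N ≠ 0 := hN ▸ (by positivity)
    rw [ZMod.addOrderOf_coe β hN0, hN, Nat.gcd_mul_left_left, Nat.mul_div_cancel m hβ0]
  refine ⟨horder, hm, fun ⟨C, hC⟩ => ?_⟩
  exact Nat.not_even_iff_odd.mpr hm (horder ▸ hC.even_addOrderOf)
end

section
/- Let α be a real number with 0 < α ≤ 1 and let Δ be a real number. Let (y_i)_{i≥0} and (n_i)_{i≥0} be real sequences with n_0 = 0 and arbitrary y_0, satisfying for all i ≥ 1: n_i = (1−α)·n_{i−1} + α·y_{i−1} and y_i = y_{i−1} + Δ − n_i. Then y_i converges to Δ as i → ∞ (and n_i converges to Δ as well). Equivalently, if the input x_i = Δo_i − ΔD_{c,i} is a constant Δ, the slack time ST_i converges to Δ + ST_target. -/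
open Filter Topology

/-- The quadratic form `(1 - α) * (n i - Δ) ^ 2 + α * (y i - Δ) ^ 2` is multiplied by `1 - α`
at each step of the recursion. -/
theorem slack_energy_eq (α Δ : ℝ) (y n : ℕ → ℝ)
    (hn : ∀ i : ℕ, n (i + 1) = (1 - α) * n i + α * y i)
    (hy : ∀ i : ℕ, y (i + 1) = y i + Δ - n (i + 1)) (i : ℕ) :
    (1 - α) * (n i - Δ) ^ 2 + α * (y i - Δ) ^ 2 =
      (1 - α) ^ i * ((1 - α) * (n 0 - Δ) ^ 2 + α * (y 0 - Δ) ^ 2) := by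
  induction i with
  | zero => simp
  | succ i ih =>
    rw [pow_succ' (1 - α) i, mul_assoc (1 - α), ← ih, hy, hn]
    ring

theorem slack_converges_of_constant_input
    (α : ℝ) (hα0 : 0 < α) (hα1 : α ≤ 1) (Δ : ℝ)
    (y n : ℕ → ℝ) (hn0 : n 0 = 0)
    (hn : ∀ i : ℕ, 1 ≤ i → n i = (1 - α) * n (i - 1) + α * y (i - 1))
    (hy : ∀ i : ℕ, 1 ≤ i → y i = y (i - 1) + Δ - n i) :
    Tendsto y atTop (𝓝 Δ) ∧ Tendsto n atTop (𝓝 Δ) := by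
  have hn' : ∀ i : ℕ, n (i + 1) = (1 - α) * n i + α * y i := fun i => hn (i + 1) (by omega)
  have hy' : ∀ i : ℕ, y (i + 1) = y i + Δ - n (i + 1) := fun i => hy (i + 1) (by omega)
  have hpow : Tendsto (fun i : ℕ => (1 - α) ^ i) atTop (𝓝 0) :=
    tendsto_pow_atTop_nhds_zero_of_lt_one (by linarith) (by linarith)
  have hsq : Tendsto (fun i => (y i - Δ) ^ 2) atTop (𝓝 0) := by
    set V := (1 - α) * (n 0 - Δ) ^ 2 + α * (y 0 - Δ) ^ 2 with hV
    have hbound : Tendsto (fun i : ℕ => (1 - α) ^ i * (V / α)) atTop (𝓝 0) := by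
      simpa using hpow.mul_const (V / α)
    refine squeeze_zero (fun i => sq_nonneg _) (fun i => ?_) hbound
    rw [← mul_div_assoc, le_div_iff₀ hα0, hV, ← slack_energy_eq α Δ y n hn' hy' i]
    have := mul_nonneg (sub_nonneg.2 hα1) (sq_nonneg (n i - Δ))
    linarith
  have hylim : Tendsto y atTop (𝓝 Δ) := by
    rw [← tendsto_sub_nhds_zero_iff, tendsto_zero_iff_abs_tendsto_zero]
    simpa [Function.comp_def, Real.sqrt_sq_eq_abs] using hsq.sqrt
  refine ⟨hylim, (tendsto_add_atTop_iff_nat 1).1 ?_⟩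
  have hdiff := (hylim.add_const Δ).sub ((tendsto_add_atTop_iff_nat 1).2 hylim)
  rw [add_sub_cancel_right] at hdiff
  refine hdiff.congr fun i => ?_
  rw [hy' i]
  ring
end

section
/- Let α be a real number with 0 < α ≤ 1 and let M ≥ 0 be a real number. Let (x_i)_{i≥1} be a real sequence with |x_i| ≤ M for all i ≥ 1, and let (y_i)_{i≥0}, (n_i)_{i≥0} be real sequences with n_0 = 0 satisfying for all i ≥ 1: n_i = (1−α)·n_{i−1} + α·y_{i−1} and y_i = y_{i−1} + x_i − n_i. Then the output is bounded: there exists a real constant B such that |y_i| ≤ B for all i ≥ 0. That is, the adaptive synchronization feedback system is stable (bounded input implies bounded output). -/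
/-- The weighted energy `α y² + (1 - α) n²` contracts by the factor `1 - α²` in one step of the
feedback loop, up to a term controlled by the input. -/
theorem weighted_energy_step_le {α : ℝ} (hα0 : 0 < α) (hα1 : α ≤ 1) (x y n : ℝ) :
    α * (y + x - ((1 - α) * n + α * y)) ^ 2 + (1 - α) * ((1 - α) * n + α * y) ^ 2 ≤
      (1 - α ^ 2) * (α * y ^ 2 + (1 - α) * n ^ 2) + (1 + α) * x ^ 2 := by
  have h₁ : 0 ≤ (α * ((1 - α) * (y - n)) - x) ^ 2 := sq_nonneg _
  have h₂ : 0 ≤ α * (1 - α) * ((1 - α) * n + α * y) ^ 2 :=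
    mul_nonneg (mul_nonneg hα0.le (sub_nonneg.2 hα1)) (sq_nonneg _)
  linear_combination h₁ + h₂

theorem adaptive_sync_bibo_stable
    (α : ℝ) (hα0 : 0 < α) (hα1 : α ≤ 1) (M : ℝ) (hM : 0 ≤ M)
    (x y n : ℕ → ℝ) (hn0 : n 0 = 0)
    (hx : ∀ i : ℕ, 1 ≤ i → |x i| ≤ M)
    (hn : ∀ i : ℕ, 1 ≤ i → n i = (1 - α) * n (i - 1) + α * y (i - 1))
    (hy : ∀ i : ℕ, 1 ≤ i → y i = y (i - 1) + x i - n i) :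
    ∃ B : ℝ, ∀ i : ℕ, |y i| ≤ B := by
  set C : ℝ := (1 + α) * M ^ 2 / α ^ 2 with hC
  have hC0 : 0 ≤ C := by positivity
  have hCα : α ^ 2 * C = (1 + α) * M ^ 2 := by rw [hC]; field_simp
  set K : ℝ := α * y 0 ^ 2 + C with hK
  have hCK : C ≤ K := le_add_of_nonneg_left (by positivity)
  have hV : ∀ i, α * y i ^ 2 + (1 - α) * n i ^ 2 ≤ K := by
    intro i
    induction i with
    | zero => rw [hn0]; linarith
    | succ i ih =>
      have hni := hn (i + 1) (by omega)
      have hyi := hy (i + 1) (by omega)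
      rw [Nat.add_sub_cancel] at hni hyi
      rw [hyi, hni]
      have hx2 : x (i + 1) ^ 2 ≤ M ^ 2 := sq_le_sq.2 ((hx _ (by omega)).trans (le_abs_self M))
      have hx3 : (1 + α) * x (i + 1) ^ 2 ≤ (1 + α) * M ^ 2 := by gcongr
      have hα2 : 0 ≤ 1 - α ^ 2 := by nlinarith
      have h₁ := mul_le_mul_of_nonneg_left ih hα2
      have h₂ := mul_le_mul_of_nonneg_left hCK (sq_nonneg α)
      linarith [weighted_energy_step_le hα0 hα1 (x (i + 1)) (y i) (n i)]
  refine ⟨√(K / α), fun i => Real.abs_le_sqrt ?_⟩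
  rw [le_div_iff₀ hα0]
  linarith [hV i, mul_nonneg (sub_nonneg.2 hα1) (sq_nonneg (n i))]
end

section
/- Let α be a real number with 0 < α ≤ 1, let Δ, ST_target, and D_c be real numbers, and let (y_i)_{i≥0}, (n_i)_{i≥0} be real sequences with n_0 = 0 satisfying for all i ≥ 1: n_i = (1−α)·n_{i−1} + α·y_{i−1} and y_i = y_{i−1} + Δ − n_i. Define the age of information at transmission of packet i as AoI_i = (ST_target + y_i) + D_c (i.e., the slack time ST_i plus the constant client processing delay D_c). Then AoI_i converges to Δ + ST_target + D_c as i → ∞; in particular, the sequence (AoI_i) is bounded, so the JIT system has bounded age of information even when the JIT clock and the MAC clock drift apart at a constant rate Δ per TDMA round. -/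
open Filter Topology

/-- The quadratic form `(1 - α) (n - Δ)² + α (y - Δ)²` contracts by the factor `1 - α` at each
step of the recursion. -/
lemma energy_eq_pow_mul (α Δ : ℝ) (y n : ℕ → ℝ)
    (hn : ∀ i, n (i + 1) = (1 - α) * n i + α * y i)
    (hy : ∀ i, y (i + 1) = y i + Δ - n (i + 1)) (i : ℕ) :
    (1 - α) * (n i - Δ) ^ 2 + α * (y i - Δ) ^ 2 =
      (1 - α) ^ i * ((1 - α) * (n 0 - Δ) ^ 2 + α * (y 0 - Δ) ^ 2) := by
  induction i with
  | zero => simp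
  | succ i ih =>
    rw [pow_succ' (1 - α) i, mul_assoc (1 - α) ((1 - α) ^ i), ← ih, hy, hn]
    ring

lemma tendsto_deviation (α : ℝ) (hα0 : 0 < α) (hα1 : α ≤ 1) (Δ : ℝ) (y n : ℕ → ℝ)
    (hn : ∀ i, n (i + 1) = (1 - α) * n i + α * y i)
    (hy : ∀ i, y (i + 1) = y i + Δ - n (i + 1)) :
    Tendsto y atTop (𝓝 Δ) := by
  set C := (1 - α) * (n 0 - Δ) ^ 2 + α * (y 0 - Δ) ^ 2
  have hle : ∀ i, (y i - Δ) ^ 2 ≤ (1 - α) ^ i * (C / α) := fun i ↦ by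
    have h := energy_eq_pow_mul α Δ y n hn hy i
    rw [← mul_div_assoc, le_div_iff₀ hα0, ← h]
    nlinarith [mul_nonneg (sub_nonneg.2 hα1) (sq_nonneg (n i - Δ))]
  have hpow : Tendsto (fun i : ℕ ↦ (1 - α) ^ i * (C / α)) atTop (𝓝 0) := by
    simpa using (tendsto_pow_atTop_nhds_zero_of_lt_one (sub_nonneg.2 hα1)
      (sub_lt_self 1 hα0)).mul_const (C / α)
  have hsq : Tendsto (fun i ↦ (y i - Δ) ^ 2) atTop (𝓝 0) :=
    squeeze_zero (fun i ↦ sq_nonneg _) hle hpow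
  have habs : Tendsto (fun i ↦ |y i - Δ|) atTop (𝓝 0) := by
    simpa [Real.sqrt_sq_eq_abs] using hsq.sqrt
  exact tendsto_sub_nhds_zero_iff.1 ((tendsto_zero_iff_abs_tendsto_zero _).2 habs)

theorem aoi_bounded_under_constant_drift
    (α : ℝ) (hα0 : 0 < α) (hα1 : α ≤ 1) (Δ STtarget Dc : ℝ)
    (y n : ℕ → ℝ) (hn0 : n 0 = 0)
    (hn : ∀ i : ℕ, 1 ≤ i → n i = (1 - α) * n (i - 1) + α * y (i - 1))
    (hy : ∀ i : ℕ, 1 ≤ i → y i = y (i - 1) + Δ - n i)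
    (AoI : ℕ → ℝ) (hAoI : ∀ i : ℕ, AoI i = (STtarget + y i) + Dc) :
    Tendsto AoI atTop (𝓝 (Δ + STtarget + Dc)) ∧ ∃ B : ℝ, ∀ i : ℕ, |AoI i| ≤ B := by
  have hlim : Tendsto y atTop (𝓝 Δ) := tendsto_deviation α hα0 hα1 Δ y n
    (fun i ↦ hn (i + 1) (Nat.le_add_left 1 i)) (fun i ↦ hy (i + 1) (Nat.le_add_left 1 i))
  have hA : Tendsto AoI atTop (𝓝 (Δ + STtarget + Dc)) := by
    rw [funext hAoI, add_comm Δ]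
    exact (hlim.const_add STtarget).add_const Dc
  obtain ⟨B, hB⟩ := hA.abs.bddAbove_range
  exact ⟨hA, B, fun i ↦ hB ⟨i, rfl⟩⟩
end
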